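/- Let R be a commutative ring, A an R-algebra isomorphic to a polynomial algebra in finitely many variables over R, and B a commutative A-algebra that is flat as an A-module. Let I₃ ⊆ B ⊗_R B be the ideal generated by the elements ā⊗1 − 1⊗ā for a ∈ A (ā the image of a in B), set C̃_ħ := DNC_{I₃}(B ⊗_R B), and let f₁, f₂ : B[ħ] → C̃_ħ be the two structure homomorphisms induced by the two tensor factors. Form the tensor product C̃_ħ ⊗_{B[ħ]} C̃_ħ, where the left factor is regarded as a B[ħ]-module via f₂ and the right factor via f₁. Then the R[ħ]-algebra homomorphism (B ⊗_R B)[ħ] → C̃_ħ ⊗_{B[ħ]} C̃_ħ determined by b⊗1 ↦ f₁(b)⊗1 and 1⊗b ↦ 1⊗f₂(b) sends every element of I₃ into ħ · (C̃_ħ ⊗_{B[ħ]} C̃_ħ), and it extends uniquely to an R[ħ]-algebra homomorphism C̃_ħ → C̃_ħ ⊗_{B[ħ]} C̃_ħ. -/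

import Mathlib

set_option synthInstance.maxHeartbeats 1000000
set_option maxHeartbeats 1600000

open scoped TensorProduct

noncomputable section

/-- The deformation to the normal cone `DNC_I(A)` of a commutative ring `A` along an ideal
`I ⊆ A`: the `A`-subalgebra of the Laurent polynomial ring `A[ħ, ħ⁻¹]` generated by `A[ħ]`
(i.e. by `ħ`) together with the elements `ħ⁻¹ · f` for `f ∈ I`. -/
def DNC (A : Type*) [CommRing A] (I : Ideal A) :
    Subalgebra A (LaurentPolynomial A) :=
  Algebra.adjoin A
    ({LaurentPolynomial.T 1} ∪
      {x | ∃ f ∈ I, x = LaurentPolynomial.C f * LaurentPolynomial.T (-1)})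

/-- A type synonym for `M`, regarded as a `P`-algebra (hence `P`-module) via the ring
homomorphism `f : P →+* M`. -/
def ModVia {P M : Type*} [CommSemiring P] [CommRing M] (_f : P →+* M) : Type _ := M

/-- The identity map `M → ModVia f`. -/
def ModVia.mk {P M : Type*} [CommSemiring P] [CommRing M] (f : P →+* M) (m : M) :
    ModVia f := m

instance {P M : Type*} [CommSemiring P] [CommRing M] (f : P →+* M) : CommRing (ModVia f) :=
  inferInstanceAs (CommRing M)

instance {P M : Type*} [CommSemiring P] [CommRing M] (f : P →+* M) :
    Algebra P (ModVia f) :=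
  f.toAlgebra

namespace DNC

section Lift

variable {S M : Type*} [CommRing S] [CommRing M] {I : Ideal S}

theorem T_one_mem : (LaurentPolynomial.T 1 : LaurentPolynomial S) ∈ DNC S I :=
  Algebra.subset_adjoin (Or.inl rfl)

theorem C_mem (s : S) : LaurentPolynomial.C s ∈ DNC S I :=
  (DNC S I).algebraMap_mem s

theorem C_mul_T_mem {s : S} (hs : s ∈ I) :
    LaurentPolynomial.C s * LaurentPolynomial.T (-1) ∈ DNC S I :=
  Algebra.subset_adjoin (Or.inr ⟨s, hs, rfl⟩)

/-- A subring of the Laurent polynomials containing the generators contains `DNC S I`. -/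
theorem mem_of_generators (K : Subring (LaurentPolynomial S))
    (hC : ∀ s, LaurentPolynomial.C s ∈ K) (hT : LaurentPolynomial.T 1 ∈ K)
    (hI : ∀ s ∈ I, LaurentPolynomial.C s * LaurentPolynomial.T (-1) ∈ K)
    {x : LaurentPolynomial S} (hx : x ∈ DNC S I) : x ∈ K := by
  refine Algebra.adjoin_induction (p := fun x _ => x ∈ K) ?_ hC
    (fun _ _ _ _ => K.add_mem) (fun _ _ _ _ => K.mul_mem) hx
  rintro _ (rfl | ⟨f, hf, rfl⟩)
  exacts [hT, hI f hf]

/-- A homomorphism from `S[ħ]` under which `ħ` becomes regular and which sends `I` into the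
multiples of `ħ` extends to `DNC S I`. -/
theorem exists_lift (g : Polynomial S →+* M) (hreg : IsLeftRegular (g Polynomial.X))
    (hI : ∀ s ∈ I, ∃ q, g (Polynomial.C s) = g Polynomial.X * q) :
    ∃ Φ : DNC S I →+* M, ∀ (p : Polynomial S) (y : DNC S I),
      (y : LaurentPolynomial S) = Polynomial.toLaurent p → Φ y = g p := by
  set h := g Polynomial.X with hh
  let j : M →+* Localization.Away h := algebraMap M (Localization.Away h)
  have hj : Function.Injective j := by
    refine IsLocalization.injective (M := Submonoid.powers h) _ ?_
    rw [Submonoid.powers_le]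
    exact (isLeftRegular_iff_isRegular.mp hreg).mem_nonZeroDivisors
  have hu : IsUnit (j h) := IsLocalization.Away.algebraMap_isUnit h
  let Ψ : LaurentPolynomial S →+* Localization.Away h :=
    LaurentPolynomial.eval₂ (j.comp (g.comp Polynomial.C)) hu.unit
  have hΨ : ∀ p, Ψ (Polynomial.toLaurent p) = j (g p) := by
    have : Ψ.comp Polynomial.toLaurent = j.comp g := by
      ext <;> simp [Ψ, hh]
    exact fun p => congrArg (fun f => f p) this
  have hmem : ∀ y : DNC S I, Ψ y ∈ j.range := by
    intro y
    refine mem_of_generators (j.range.comap Ψ) ?_ ?_ ?_ y.2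
    · intro s
      exact ⟨g (Polynomial.C s), by rw [← hΨ]; simp⟩
    · exact ⟨g Polynomial.X, by rw [← hΨ]; simp⟩
    · intro s hs
      obtain ⟨q, hq⟩ := hI s hs
      refine ⟨q, hu.mul_left_cancel ?_⟩
      have hX : j h = Ψ (LaurentPolynomial.T 1) := by
        rw [← Polynomial.toLaurent_X, hΨ]
      rw [← map_mul, ← hq, ← hΨ, hX, ← map_mul, Polynomial.toLaurent_C, mul_left_comm,
        ← LaurentPolynomial.T_add]
      simp
  let e : M ≃+* j.range := RingEquiv.ofBijective j.rangeRestrict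
    ⟨fun a b hab => hj (congrArg Subtype.val hab), j.rangeRestrict_surjective⟩
  refine ⟨e.symm.toRingHom.comp
    ((Ψ.comp (DNC S I).val.toRingHom).codRestrict j.range hmem), fun p y hy => ?_⟩
  refine e.injective ((e.apply_symm_apply _).trans (Subtype.ext ?_))
  change Ψ y = j (g p)
  rw [hy, hΨ]

/-- Homomorphisms from `DNC S I` to a ring in which `ħ` becomes regular are determined on
polynomials. -/
theorem hom_ext {Φ Φ' : DNC S I →+* M}
    (hreg : IsLeftRegular (Φ ⟨LaurentPolynomial.T 1, T_one_mem⟩))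
    (h : ∀ (p : Polynomial S) (y : DNC S I),
      (y : LaurentPolynomial S) = Polynomial.toLaurent p → Φ y = Φ' y) : Φ = Φ' := by
  ext y
  obtain ⟨n, p, hp⟩ := LaurentPolynomial.exists_T_pow (y : LaurentPolynomial S)
  set t : DNC S I := ⟨LaurentPolynomial.T 1, T_one_mem⟩ with ht
  have h1 : Φ t = Φ' t := h Polynomial.X t (by simp [ht])
  have h2 : Φ (t ^ n * y) = Φ' (t ^ n * y) := by
    refine h p _ ?_
    rw [hp]
    simp [ht, mul_comm]
  rw [map_mul, map_mul, map_pow, map_pow, ← h1] at h2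
  exact hreg.pow n h2

end Lift

/-- The pushout of a flat ring homomorphism, given by its universal property. -/
theorem exists_flat_pushout {A B Q : Type} [CommRing A] [CommRing B] [CommRing Q]
    (θ : A →+* Q) (β : A →+* B) (hβ : β.Flat) :
    ∃ (E : Type) (_ : CommRing E) (j₁ : Q →+* E) (j₂ : B →+* E), j₁.Flat ∧
      j₁.comp θ = j₂.comp β ∧
      (∀ K : Subring E, (∀ q, j₁ q ∈ K) → (∀ b, j₂ b ∈ K) → ∀ e, e ∈ K) ∧
      ∀ (L : Type) [CommRing L] (u : Q →+* L) (v : B →+* L), u.comp θ = v.comp β →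
        ∃ φ : E →+* L, φ.comp j₁ = u ∧ φ.comp j₂ = v := by
  algebraize [θ, β]
  refine ⟨Q ⊗[A] B, inferInstance, Algebra.TensorProduct.includeLeftRingHom,
    (Algebra.TensorProduct.includeRight (R := A) (A := Q) (B := B)).toRingHom, ?_, ?_, ?_, ?_⟩
  · exact (RingHom.flat_algebraMap_iff (R := Q) (S := Q ⊗[A] B)).mpr inferInstance
  · ext a
    exact Algebra.TensorProduct.tmul_one_eq_one_tmul a
  · intro K h₁ h₂ e
    induction e using TensorProduct.induction_on with
    | zero => exact K.zero_mem
    | add x y hx hy => exact K.add_mem hx hy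
    | tmul q b =>
      have := K.mul_mem (h₁ q) (h₂ b)
      simpa using this
  · intro L _ u v huv
    let _ : Algebra A L := (v.comp β).toAlgebra
    let u' : Q →ₐ[A] L := { u with commutes' := fun a => congrArg (fun f => f a) huv }
    let v' : B →ₐ[A] L := { v with commutes' := fun a => rfl }
    refine ⟨(Algebra.TensorProduct.productMap u' v').toRingHom, ?_, ?_⟩
    · ext q
      change Algebra.TensorProduct.productMap u' v' (q ⊗ₜ 1) = u q
      simp [u']
    · ext b
      change Algebra.TensorProduct.productMap u' v' (1 ⊗ₜ b) = v b
      simp [v']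

/-- The first structure homomorphism `B[ħ] → DNC (B ⊗[R] B) I` is flat. -/
theorem flat_left {R A B : Type} [CommRing R] [CommRing A] [Algebra R A]
    {n : ℕ} (ε : MvPolynomial (Fin n) R ≃ₐ[R] A)
    [CommRing B] [Algebra R B] [Algebra A B] [IsScalarTower R A B] [Module.Flat A B]
    (I : Ideal (B ⊗[R] B))
    (hI : I = Ideal.span
      {x | ∃ a : A, x = algebraMap A B a ⊗ₜ[R] (1 : B) - (1 : B) ⊗ₜ[R] algebraMap A B a})
    (f : Polynomial B →+* DNC (B ⊗[R] B) I)
    (hfC : ∀ b : B, (f (Polynomial.C b) : LaurentPolynomial (B ⊗[R] B)) =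
      LaurentPolynomial.C (b ⊗ₜ[R] (1 : B)))
    (hfX : (f Polynomial.X : LaurentPolynomial (B ⊗[R] B)) = LaurentPolynomial.T 1) :
    f.Flat := by
  let β := algebraMap A B
  let x : Fin n → B := fun i => β (ε (MvPolynomial.X i))
  let θ : A →+* MvPolynomial (Fin n) (Polynomial B) :=
    (MvPolynomial.eval₂Hom
      (MvPolynomial.C.comp (Polynomial.C.comp (algebraMap R B)))
      (fun i => MvPolynomial.C (Polynomial.C (x i)) +
        MvPolynomial.C Polynomial.X * MvPolynomial.X i)).comp ε.symm.toAlgHom.toRingHom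
  have hθ : ∀ p, θ (ε p) = MvPolynomial.eval₂Hom
      (MvPolynomial.C.comp (Polynomial.C.comp (algebraMap R B)))
      (fun i => MvPolynomial.C (Polynomial.C (x i)) +
        MvPolynomial.C Polynomial.X * MvPolynomial.X i) p := by
    intro p
    simp [θ]
  have hε : ∀ {L : Type} [CommRing L] {u v : A →+* L},
      (u.comp (ε : MvPolynomial (Fin n) R →+* A) = v.comp (ε : MvPolynomial (Fin n) R →+* A)) →
      u = v := by
    intro L _ u v h
    ext a
    obtain ⟨p, rfl⟩ := ε.surjective a
    exact congrArg (fun f => f p) h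
  have hεC : ∀ r, ε (MvPolynomial.C r) = algebraMap R A r := fun r => ε.commutes r
  have hθC : ∀ r, θ (algebraMap R A r) = MvPolynomial.C (Polynomial.C (algebraMap R B r)) := by
    intro r
    rw [← hεC, hθ, MvPolynomial.eval₂Hom_C]
    rfl
  obtain ⟨E, _, j₁, j₂, hj₁, hcomm, hgen, huniv⟩ := exists_flat_pushout θ β
    (RingHom.flat_algebraMap_iff.mpr inferInstance)
  have hcomm' : ∀ a, j₁ (θ a) = j₂ (β a) := fun a => congrArg (fun f => f a) hcomm
  let i₁ : B →+* B ⊗[R] B := Algebra.TensorProduct.includeLeftRingHom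
  let i₂ : B →+* B ⊗[R] B :=
    (Algebra.TensorProduct.includeRight (R := R) (A := B) (B := B)).toRingHom
  have hi₁ : ∀ b, i₁ b = b ⊗ₜ[R] (1 : B) := fun _ => rfl
  have hi₂ : ∀ b, i₂ b = (1 : B) ⊗ₜ[R] b := fun _ => rfl
  have hi : ∀ r, i₁ (algebraMap R B r) = i₂ (algebraMap R B r) := fun r =>
    Algebra.TensorProduct.tmul_one_eq_one_tmul r
  have hβR : ∀ r, β (algebraMap R A r) = algebraMap R B r := fun r =>
    (IsScalarTower.algebraMap_apply R A B r).symm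
  let w : Polynomial B →+* LaurentPolynomial (B ⊗[R] B) := (DNC (B ⊗[R] B) I).val.toRingHom.comp f
  have hwC : ∀ b, w (Polynomial.C b) = LaurentPolynomial.C (i₁ b) := hfC
  have hwX : w Polynomial.X = LaurentPolynomial.T 1 := hfX
  let u : MvPolynomial (Fin n) (Polynomial B) →+* LaurentPolynomial (B ⊗[R] B) :=
    MvPolynomial.eval₂Hom w
      (fun i => LaurentPolynomial.C (i₂ (x i) - i₁ (x i)) * LaurentPolynomial.T (-1))
  obtain ⟨φ, hφ₁, hφ₂⟩ := huniv _ u (LaurentPolynomial.C.comp i₂) <| by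
    apply hε
    refine MvPolynomial.ringHom_ext (fun k => ?_) fun i => ?_
    · simp only [RingHom.comp_apply, RingHom.coe_coe, u, hεC, hθC, MvPolynomial.eval₂Hom_C,
        hwC, hβR, hi]
    · simp only [RingHom.comp_apply, RingHom.coe_coe, hθ, u, MvPolynomial.coe_eval₂Hom,
        MvPolynomial.eval₂_X, MvPolynomial.eval₂_add, MvPolynomial.eval₂_mul,
        MvPolynomial.eval₂_C, hwC, hwX]
      rw [mul_left_comm, ← LaurentPolynomial.T_add]
      simp [x]
  have hφj₁ : ∀ q, φ (j₁ q) = u q := fun q => congrArg (fun f => f q) hφ₁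
  have hφj₂ : ∀ b, φ (j₂ b) = LaurentPolynomial.C (i₂ b) := fun q => congrArg (fun f => f q) hφ₂
  have hflat : (j₁.comp MvPolynomial.C).Flat := by
    refine RingHom.Flat.comp ?_ hj₁
    exact (RingHom.flat_algebraMap_iff (R := Polynomial B)
      (S := MvPolynomial (Fin n) (Polynomial B))).mpr inferInstance
  let t : E := j₁ (MvPolynomial.C Polynomial.X)
  have ht : IsLeftRegular t := by
    algebraize [j₁.comp MvPolynomial.C]
    have := Module.Flat.isSMulRegular_of_isRegular (M := E)
      (Polynomial.Monic.isRegular (Polynomial.monic_X (R := B)))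
    intro a b hab
    apply this
    simpa [Algebra.smul_def, RingHom.algebraMap_toAlgebra] using hab
  obtain ⟨σ₀, hσ₁, hσ₂⟩ : ∃ σ₀ : B ⊗[R] B →+* E,
      (∀ b, σ₀ (i₁ b) = j₁ (MvPolynomial.C (Polynomial.C b))) ∧ ∀ b, σ₀ (i₂ b) = j₂ b := by
    let _ : Algebra R E := (j₂.comp (algebraMap R B)).toAlgebra
    let v₁ : B →ₐ[R] E :=
      { j₁.comp (MvPolynomial.C.comp Polynomial.C) with
        commutes' := fun r => by
          change j₁ (MvPolynomial.C (Polynomial.C (algebraMap R B r))) = j₂ (algebraMap R B r)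
          rw [← hβR, ← hcomm', hθC, hβR] }
    let v₂ : B →ₐ[R] E := { j₂ with commutes' := fun r => rfl }
    refine ⟨(Algebra.TensorProduct.productMap v₁ v₂).toRingHom, fun b => ?_, fun b => ?_⟩
    · change Algebra.TensorProduct.productMap v₁ v₂ (b ⊗ₜ 1) = _
      simp [v₁]
    · change Algebra.TensorProduct.productMap v₁ v₂ (1 ⊗ₜ b) = _
      simp [v₂]
  let σ : Polynomial (B ⊗[R] B) →+* E := Polynomial.eval₂RingHom σ₀ t
  have hσC : ∀ s, σ (Polynomial.C s) = σ₀ s := fun s => by simp [σ]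
  have hσX : σ Polynomial.X = t := by simp [σ]
  have hφt : φ t = LaurentPolynomial.T 1 := by simp [t, hφj₁, u, hwX]
  have hφσ₀ : ∀ s, φ (σ₀ s) = LaurentPolynomial.C s := by
    intro s
    induction s using TensorProduct.induction_on with
    | zero => simp
    | add a b ha hb => simp [ha, hb]
    | tmul a b =>
      have : a ⊗ₜ[R] b = i₁ a * i₂ b := by simp [hi₁, hi₂]
      rw [this, map_mul, map_mul, hσ₁, hσ₂, hφj₁, hφj₂, map_mul]
      simp [u, hwC]
  have hφσ : ∀ p, φ (σ p) = Polynomial.toLaurent p := by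
    have : φ.comp σ = Polynomial.toLaurent := by
      refine Polynomial.ringHom_ext (fun s => ?_) ?_
      · simp [hσC, hφσ₀]
      · simp [hσX, hφt]
    exact fun p => congrArg (fun f => f p) this
  have hcx : ∀ i, j₁ (MvPolynomial.C (Polynomial.C (x i))) + t * j₁ (MvPolynomial.X i) =
      j₂ (x i) := by
    intro i
    rw [← hcomm', hθ]
    simp [t]
  have htorsion : ∀ e : E, ∃ (k : ℕ) (p : Polynomial (B ⊗[R] B)), t ^ k * e = σ p := by
    let K : Subring E :=
      { carrier := {e | ∃ (k : ℕ) (p : Polynomial (B ⊗[R] B)), t ^ k * e = σ p}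
        zero_mem' := ⟨0, 0, by simp⟩
        one_mem' := ⟨0, 1, by simp⟩
        neg_mem' := by
          rintro a ⟨k, p, h⟩
          exact ⟨k, -p, by rw [map_neg, ← h, mul_neg]⟩
        add_mem' := by
          rintro a b ⟨k, p, h⟩ ⟨l, q, h'⟩
          refine ⟨k + l, Polynomial.X ^ l * p + Polynomial.X ^ k * q, ?_⟩
          simp only [map_add, map_mul, map_pow, hσX, ← h, ← h']
          ring
        mul_mem' := by
          rintro a b ⟨k, p, h⟩ ⟨l, q, h'⟩
          refine ⟨k + l, p * q, ?_⟩
          simp only [map_mul, ← h, ← h']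
          ring }
    refine hgen K (fun q => ?_) (fun b => ⟨0, Polynomial.C (i₂ b), by simp [hσC, hσ₂]⟩)
    have hP : ∀ p : Polynomial B, j₁ (MvPolynomial.C p) ∈ K := by
      intro p
      induction p using Polynomial.induction_on' with
      | add p q hp hq => simpa using K.add_mem hp hq
      | monomial m b =>
        rw [← Polynomial.C_mul_X_pow_eq_monomial, map_mul, map_pow, map_mul, map_pow]
        refine K.mul_mem ⟨0, Polynomial.C (i₁ b), by simp [hσC, hσ₁]⟩ (K.pow_mem ?_ m)
        exact ⟨0, Polynomial.X, by simp [hσX, t]⟩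
    induction q using MvPolynomial.induction_on with
    | C p => exact hP p
    | add p q hp hq => simpa using K.add_mem hp hq
    | mul_X p i hp =>
      rw [map_mul]
      refine K.mul_mem hp ⟨1, Polynomial.C (i₂ (x i) - i₁ (x i)), ?_⟩
      rw [hσC, map_sub, hσ₁, hσ₂, ← hcx]
      ring
  have hφinj : Function.Injective φ := by
    rw [injective_iff_map_eq_zero]
    intro e he
    obtain ⟨k, p, hp⟩ := htorsion e
    have h0 : Polynomial.toLaurent p = 0 := by rw [← hφσ, ← hp, map_mul, he, mul_zero]
    rw [Polynomial.toLaurent_eq_zero] at h0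
    apply ht.pow k
    simp [hp, h0]
  have hgenI : ∀ a : A, i₁ (β a) - i₂ (β a) ∈ I := fun a =>
    hI ▸ Ideal.subset_span ⟨a, rfl⟩
  have hφmem : ∀ e, φ e ∈ DNC (B ⊗[R] B) I := by
    refine hgen ((DNC (B ⊗[R] B) I).toSubring.comap φ) (fun q => ?_) (fun b => ?_)
    · change φ (j₁ q) ∈ DNC (B ⊗[R] B) I
      rw [hφj₁]
      induction q using MvPolynomial.induction_on with
      | C p =>
        rw [MvPolynomial.eval₂Hom_C]
        exact (f p).2
      | add p q hp hq => simpa using add_mem hp hq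
      | mul_X p i hp =>
        rw [map_mul]
        refine mul_mem hp ?_
        have h : i₂ (x i) - i₁ (x i) ∈ I := by
          rw [← neg_sub]
          exact I.neg_mem (hgenI _)
        simpa [u] using C_mul_T_mem h
    · change φ (j₂ b) ∈ DNC (B ⊗[R] B) I
      rw [hφj₂]
      exact C_mem _
  have hφdiff : ∀ a : A, LaurentPolynomial.C (i₁ (β a) - i₂ (β a)) * LaurentPolynomial.T (-1) ∈
      φ.range := by
    have hC : ∀ s, LaurentPolynomial.C s ∈ φ.range := fun s => ⟨_, hφσ₀ s⟩
    intro a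
    obtain ⟨p, rfl⟩ := ε.surjective a
    induction p using MvPolynomial.induction_on with
    | C r => simp [hεC, hβR, hi]
    | add p q hp hq =>
      convert add_mem hp hq using 1
      simp only [map_add, map_sub]
      ring
    | mul_X p i hp =>
      have hx : LaurentPolynomial.C (i₁ (x i) - i₂ (x i)) * LaurentPolynomial.T (-1) ∈ φ.range := by
        refine ⟨-j₁ (MvPolynomial.X i), ?_⟩
        rw [map_neg, hφj₁]
        simp only [u, MvPolynomial.coe_eval₂Hom, MvPolynomial.eval₂_X, map_sub]
        ring
      convert add_mem (mul_mem hp (hC (i₁ (x i)))) (mul_mem (hC (i₂ (β (ε p)))) hx) using 1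
      simp only [map_mul, map_sub, x]
      ring
  have hφsurj : ∀ y ∈ DNC (B ⊗[R] B) I, y ∈ φ.range := by
    intro y hy
    refine mem_of_generators φ.range (fun s => ⟨_, hφσ₀ s⟩) ⟨t, hφt⟩ (fun s hs => ?_) hy
    rw [hI] at hs
    induction hs using Submodule.span_induction with
    | mem s hs =>
      obtain ⟨a, rfl⟩ := hs
      exact hφdiff a
    | zero => simp
    | add a b _ _ ha hb =>
      convert add_mem ha hb using 1
      simp only [map_add, add_mul]
    | smul a b _ hb =>
      convert mul_mem (show LaurentPolynomial.C a ∈ φ.range from ⟨_, hφσ₀ a⟩) hb using 1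
      simp only [smul_eq_mul, map_mul, mul_assoc]
  let φ' : E →+* DNC (B ⊗[R] B) I := φ.codRestrict _ hφmem
  have hbij : Function.Bijective φ' := by
    refine ⟨fun a b hab => hφinj (congrArg Subtype.val hab), fun y => ?_⟩
    obtain ⟨e, he⟩ := hφsurj y y.2
    exact ⟨e, Subtype.ext he⟩
  have hf : f = φ'.comp (j₁.comp MvPolynomial.C) := by
    refine Polynomial.ringHom_ext (fun b => ?_) ?_
    · apply Subtype.ext
      change w _ = φ (j₁ _)
      simp [hφj₁, u]
    · apply Subtype.ext
      change w _ = φ (j₁ _)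
      simp [hφj₁, u]
  rw [hf]
  exact hflat.comp (RingHom.Flat.of_bijective hbij)

end DNC

/-- **The comultiplication of §3.3.**  Let `R` be a commutative ring, `A` an `R`-algebra
isomorphic to a polynomial algebra in finitely many variables over `R`, and `B` a
commutative `A`-algebra, flat as an `A`-module.  Let `I₃ ⊆ B ⊗[R] B` be the ideal
generated by the elements `ā⊗1 - 1⊗ā` for `a ∈ A`, set `C̃_ħ := DNC_{I₃}(B ⊗[R] B)`, and
let `f₁, f₂ : B[ħ] → C̃_ħ` be the two structure homomorphisms.  Form
`C̃_ħ ⊗[B[ħ]] C̃_ħ`, the left factor a `B[ħ]`-module via `f₂` and the right one via `f₁`.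
Then the `R[ħ]`-algebra homomorphism `g : (B ⊗[R] B)[ħ] → C̃_ħ ⊗[B[ħ]] C̃_ħ` determined by
`b⊗1 ↦ f₁(b)⊗1` and `1⊗b ↦ 1⊗f₂(b)` sends every element of `I₃` into
`ħ · (C̃_ħ ⊗[B[ħ]] C̃_ħ)`, and it extends uniquely to an `R[ħ]`-algebra homomorphism
`C̃_ħ → C̃_ħ ⊗[B[ħ]] C̃_ħ` (along the inclusion `ι : (B ⊗[R] B)[ħ] ⊆ C̃_ħ`). -/
theorem stmt7 (R : Type) [CommRing R]
    (A : Type) [CommRing A] [Algebra R A]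
    (hA : ∃ n : ℕ, Nonempty (MvPolynomial (Fin n) R ≃ₐ[R] A))
    (B : Type) [CommRing B] [Algebra R B] [Algebra A B] [IsScalarTower R A B]
    [Module.Flat A B]
    (I₃ : Ideal (B ⊗[R] B))
    (hI₃ : I₃ = Ideal.span
      {x | ∃ a : A, x = algebraMap A B a ⊗ₜ[R] (1 : B) - (1 : B) ⊗ₜ[R] algebraMap A B a})
    -- the two structure morphisms `f₁, f₂ : B[ħ] → C̃_ħ`
    (f₁ f₂ : Polynomial B →+* ↥(DNC (B ⊗[R] B) I₃))
    (hf₁C : ∀ b : B, (f₁ (Polynomial.C b) : LaurentPolynomial (B ⊗[R] B)) =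
      LaurentPolynomial.C (b ⊗ₜ[R] (1 : B)))
    (hf₁X : (f₁ Polynomial.X : LaurentPolynomial (B ⊗[R] B)) = LaurentPolynomial.T 1)
    (hf₂C : ∀ b : B, (f₂ (Polynomial.C b) : LaurentPolynomial (B ⊗[R] B)) =
      LaurentPolynomial.C ((1 : B) ⊗ₜ[R] b))
    (hf₂X : (f₂ Polynomial.X : LaurentPolynomial (B ⊗[R] B)) = LaurentPolynomial.T 1)
    -- the inclusion `ι : (B ⊗[R] B)[ħ] → C̃_ħ`
    (ι : Polynomial (B ⊗[R] B) →+* ↥(DNC (B ⊗[R] B) I₃))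
    (hιC : ∀ x : B ⊗[R] B,
      (ι (Polynomial.C x) : LaurentPolynomial (B ⊗[R] B)) = LaurentPolynomial.C x)
    (hιX : (ι Polynomial.X : LaurentPolynomial (B ⊗[R] B)) = LaurentPolynomial.T 1)
    -- the morphism `g : (B ⊗[R] B)[ħ] → C̃_ħ ⊗[B[ħ]] C̃_ħ`
    (g : Polynomial (B ⊗[R] B) →+* (ModVia f₂ ⊗[Polynomial B] ModVia f₁))
    (hg₁ : ∀ b : B, g (Polynomial.C (b ⊗ₜ[R] (1 : B))) =
      ModVia.mk f₂ (f₁ (Polynomial.C b)) ⊗ₜ[Polynomial B] (1 : ModVia f₁))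
    (hg₂ : ∀ b : B, g (Polynomial.C ((1 : B) ⊗ₜ[R] b)) =
      (1 : ModVia f₂) ⊗ₜ[Polynomial B] ModVia.mk f₁ (f₂ (Polynomial.C b)))
    (hgX : g Polynomial.X =
      algebraMap (Polynomial B) (ModVia f₂ ⊗[Polynomial B] ModVia f₁) Polynomial.X) :
    -- (1) `g` sends `I₃` into `ħ · (C̃_ħ ⊗[B[ħ]] C̃_ħ)`
    (∀ c ∈ I₃, ∃ q : ModVia f₂ ⊗[Polynomial B] ModVia f₁,
      g (Polynomial.C c) = (Polynomial.X : Polynomial B) • q) ∧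
    -- (2) `g` extends uniquely to an `R[ħ]`-algebra homomorphism `C̃_ħ → C̃_ħ ⊗[B[ħ]] C̃_ħ`
    (∃! Φ : ↥(DNC (B ⊗[R] B) I₃) →+* (ModVia f₂ ⊗[Polynomial B] ModVia f₁),
      Φ.comp (ι.comp (Polynomial.mapRingHom (algebraMap R (B ⊗[R] B)))) =
        (algebraMap (Polynomial B) (ModVia f₂ ⊗[Polynomial B] ModVia f₁)).comp
          (Polynomial.mapRingHom (algebraMap R B)) ∧
      Φ.comp ι = g) := by
  obtain ⟨n, ⟨ε⟩⟩ := hA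
  have hflat : Module.Flat (Polynomial B) (ModVia f₁) :=
    DNC.flat_left ε I₃ hI₃ f₁ hf₁C hf₁X
  have hgX' : g Polynomial.X =
      ModVia.mk f₂ (f₂ Polynomial.X) ⊗ₜ[Polynomial B] (1 : ModVia f₁) := hgX
  have hsmul : ∀ q : ModVia f₂ ⊗[Polynomial B] ModVia f₁,
      (Polynomial.X : Polynomial B) • q = g Polynomial.X * q := fun q => by
    rw [Algebra.smul_def, hgX]
  have hreg₂ : IsLeftRegular (ModVia.mk f₂ (f₂ Polynomial.X)) := by
    intro a b hab
    have h : (f₂ Polynomial.X).1 * Subtype.val (p := (· ∈ DNC (B ⊗[R] B) I₃)) a =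
        (f₂ Polynomial.X).1 * Subtype.val (p := (· ∈ DNC (B ⊗[R] B) I₃)) b :=
      congrArg Subtype.val hab
    rw [hf₂X] at h
    exact Subtype.ext ((LaurentPolynomial.isUnit_T 1).mul_left_cancel h)
  have hreg : IsLeftRegular (g Polynomial.X) := by
    have := Module.Flat.isSMulRegular_of_isRegular
      (M := ModVia f₂ ⊗[Polynomial B] ModVia f₁) (isLeftRegular_iff_isRegular.mp hreg₂)
    intro a b hab
    apply this
    simpa [Algebra.smul_def, hgX'] using hab
  have hgι : ∀ p, (ι p : LaurentPolynomial (B ⊗[R] B)) = Polynomial.toLaurent p := by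
    have : (DNC (B ⊗[R] B) I₃).val.toRingHom.comp ι = Polynomial.toLaurent := by
      refine Polynomial.ringHom_ext (fun s => ?_) ?_
      · rw [Polynomial.toLaurent_C]
        exact hιC s
      · rw [Polynomial.toLaurent_X]
        exact hιX
    exact fun p => congrArg (fun f => f p) this
  have hdiv : ∀ c ∈ I₃, ∃ q, g (Polynomial.C c) = g Polynomial.X * q := by
    suffices h : I₃ ≤ (Ideal.span {g Polynomial.X}).comap (g.comp Polynomial.C) from
      fun c hc => Ideal.mem_span_singleton.mp (h hc)
    conv_lhs => rw [hI₃]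
    rw [Ideal.span_le]
    rintro _ ⟨a, rfl⟩
    refine Ideal.mem_span_singleton.mpr ?_
    set b := algebraMap A B a
    have hb : b ⊗ₜ[R] (1 : B) - (1 : B) ⊗ₜ[R] b ∈ I₃ := hI₃ ▸ Ideal.subset_span ⟨a, rfl⟩
    let d : DNC (B ⊗[R] B) I₃ := ⟨_, DNC.C_mul_T_mem hb⟩
    have hd : f₁ (Polynomial.C b) - f₂ (Polynomial.C b) = f₂ Polynomial.X * d := by
      apply Subtype.ext
      change (f₁ (Polynomial.C b)).1 - (f₂ (Polynomial.C b)).1 = (f₂ Polynomial.X).1 * d.1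
      rw [hf₁C, hf₂C, hf₂X, mul_left_comm, ← LaurentPolynomial.T_add]
      simp
    have hmid (p : Polynomial B) : ModVia.mk f₂ (f₂ p) ⊗ₜ[Polynomial B] (1 : ModVia f₁) =
        (1 : ModVia f₂) ⊗ₜ[Polynomial B] ModVia.mk f₁ (f₁ p) :=
      Algebra.TensorProduct.tmul_one_eq_one_tmul p
    refine ⟨ModVia.mk f₂ d ⊗ₜ 1 + 1 ⊗ₜ ModVia.mk f₁ d, ?_⟩
    have h₁ : ModVia.mk f₂ (f₁ (Polynomial.C b)) ⊗ₜ[Polynomial B] (1 : ModVia f₁) =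
        ModVia.mk f₂ (f₂ (Polynomial.C b)) ⊗ₜ[Polynomial B] (1 : ModVia f₁) +
        ModVia.mk f₂ (f₂ Polynomial.X) ⊗ₜ[Polynomial B] (1 : ModVia f₁) *
          ModVia.mk f₂ d ⊗ₜ[Polynomial B] (1 : ModVia f₁) := by
      rw [Algebra.TensorProduct.tmul_mul_tmul, one_mul, ← TensorProduct.add_tmul]
      congr 1
      exact sub_eq_iff_eq_add'.mp hd
    have h₂ : (1 : ModVia f₂) ⊗ₜ[Polynomial B] ModVia.mk f₁ (f₁ (Polynomial.C b)) =
        (1 : ModVia f₂) ⊗ₜ[Polynomial B] ModVia.mk f₁ (f₂ (Polynomial.C b)) +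
        (1 : ModVia f₂) ⊗ₜ[Polynomial B] ModVia.mk f₁ (f₁ Polynomial.X) *
          (1 : ModVia f₂) ⊗ₜ[Polynomial B] ModVia.mk f₁ d := by
      rw [Algebra.TensorProduct.tmul_mul_tmul, one_mul, ← TensorProduct.tmul_add]
      congr 1
      have hX : f₁ Polynomial.X = f₂ Polynomial.X := Subtype.ext (hf₁X.trans hf₂X.symm)
      rw [hX]
      exact sub_eq_iff_eq_add'.mp hd
    rw [← hmid, ← hmid] at h₂
    rw [RingHom.comp_apply, map_sub, map_sub, hg₁, hg₂, h₁, h₂, hgX', mul_add]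
    abel
  refine ⟨fun c hc => ?_, ?_⟩
  · obtain ⟨q, hq⟩ := hdiv c hc
    exact ⟨q, by rw [hq, hsmul]⟩
  · obtain ⟨Φ, hΦ⟩ := DNC.exists_lift g hreg hdiv
    have hΦι : Φ.comp ι = g := RingHom.ext fun p => hΦ p _ (hgι p)
    refine ⟨Φ, ⟨?_, hΦι⟩, ?_⟩
    · rw [← RingHom.comp_assoc, hΦι]
      refine Polynomial.ringHom_ext (fun r => ?_) ?_
      · have h : algebraMap R (B ⊗[R] B) r = (1 : B) ⊗ₜ[R] algebraMap R B r :=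
          Algebra.TensorProduct.tmul_one_eq_one_tmul r
        have h' : f₂ (Polynomial.C (algebraMap R B r)) = f₁ (Polynomial.C (algebraMap R B r)) := by
          apply Subtype.ext
          rw [hf₁C, hf₂C, Algebra.TensorProduct.tmul_one_eq_one_tmul]
        simp only [RingHom.comp_apply, Polynomial.coe_mapRingHom, Polynomial.map_C]
        rw [h, hg₂, h']
        exact (Algebra.TensorProduct.tmul_one_eq_one_tmul _).symm
      · simp only [RingHom.comp_apply, Polynomial.coe_mapRingHom, Polynomial.map_X]
        exact hgX
    · rintro Φ' ⟨-, hΦ'⟩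
      refine (DNC.hom_ext ?_ fun p y hy => ?_).symm
      · rwa [hΦ Polynomial.X _ (by simp)]
      · obtain rfl : ι p = y := Subtype.ext ((hgι p).trans hy.symm)
        rw [hΦ p _ hy, ← hΦ']
        rfl
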